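/- arXiv:1404.5126 — 4 statements merged into one kernel-verified Lean document; each statement's English description precedes it below -/
import Mathlib

section
/- Fix γ ∈ [0,1) and strictly positive measurable densities f, g on a measure space (X, μ) with f^{1+γ} and g^{1+γ} integrable and with f^{1+γ}·|log(f/g)| integrable. Suppose there exist A₀ > 0 and an integrable function h such that for all A with 0 < |A| ≤ A₀, both f^{1+γ−A} g^A ≤ h and f^{1+γ−A} g^A |log(g/f)| ≤ h pointwise μ-a.e. Then, writing B = 1 + γ − A, the function A ↦ (1/A)∫f^{1+γ} dμ − ((1+γ)/(AB))∫ f^B g^A dμ + (1/B)∫ g^{1+γ} dμ tends, as A → 0 with A ≠ 0, to the limit ∫ f^{1+γ} log(f/g) dμ − (1/(1+γ))∫ (f^{1+γ} − g^{1+γ}) dμ. -/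
open MeasureTheory Filter Topology

/-- Weighted geometric interpolation written as an exponential in the weight. -/
lemma rpow_sub_mul_rpow_eq_mul_exp {a b : ℝ} (ha : 0 < a) (hb : 0 < b) (c t : ℝ) :
    a ^ (c - t) * b ^ t = a ^ c * Real.exp (t * Real.log (b / a)) := by
  rw [Real.rpow_def_of_pos ha, Real.rpow_def_of_pos hb, Real.rpow_def_of_pos ha,
    ← Real.exp_add, ← Real.exp_add, Real.log_div hb.ne' ha.ne']
  congr 1
  ring

lemma exp_mul_le_exp_add_exp_neg {t T : ℝ} (ht : |t| ≤ T) (l : ℝ) :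
    Real.exp (t * l) ≤ Real.exp (T * l) + Real.exp (-T * l) := by
  obtain ⟨h₁, h₂⟩ := abs_le.mp ht
  rcases le_total 0 l with hl | hl
  · have := Real.exp_le_exp.mpr (mul_le_mul_of_nonneg_right h₂ hl)
    linarith [Real.exp_pos (-T * l)]
  · have := Real.exp_le_exp.mpr (mul_le_mul_of_nonpos_right h₁ hl)
    linarith [Real.exp_pos (T * l)]

/-- Differentiation under the integral sign for `∫ w * exp (t * l)` at `t = 0`, when the
derivatives at `t = T` and `t = -T` are dominated by an integrable function. -/
lemma hasDerivAt_integral_mul_exp_mul_zero {X : Type*} [MeasurableSpace X] {μ : Measure X}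
    {w l h : X → ℝ} (hw : Measurable w) (hl : Measurable l) (hw0 : ∀ x, 0 ≤ w x)
    (hwi : Integrable w μ) (hh : Integrable h μ) {T : ℝ} (hT : 0 < T)
    (hpos : ∀ᵐ x ∂μ, w x * Real.exp (T * l x) * |l x| ≤ h x)
    (hneg : ∀ᵐ x ∂μ, w x * Real.exp (-T * l x) * |l x| ≤ h x) :
    HasDerivAt (fun t : ℝ => ∫ x, w x * Real.exp (t * l x) ∂μ) (∫ x, w x * l x ∂μ) 0 := by
  have key := (hasDerivAt_integral_of_dominated_loc_of_deriv_le (μ := μ)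
    (F := fun (t : ℝ) x => w x * Real.exp (t * l x))
    (F' := fun (t : ℝ) x => w x * (Real.exp (t * l x) * l x))
    (x₀ := 0) (bound := fun x => h x + h x) (Metric.ball_mem_nhds 0 hT)
    (Eventually.of_forall fun t => by
      have : Measurable fun x => w x * Real.exp (t * l x) := by fun_prop
      exact this.aestronglyMeasurable)
    (by simpa using hwi)
    (by
      have : Measurable fun x => w x * (Real.exp (0 * l x) * l x) := by fun_prop
      exact this.aestronglyMeasurable)
    (by
      filter_upwards [hpos, hneg] with x h₁ h₂ t ht
      have ht' : |t| ≤ T := by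
        rw [mem_ball_zero_iff, Real.norm_eq_abs] at ht
        exact ht.le
      have hb := mul_le_mul_of_nonneg_left (exp_mul_le_exp_add_exp_neg ht' (l x))
        (mul_nonneg (hw0 x) (abs_nonneg (l x)))
      rw [Real.norm_eq_abs, abs_mul, abs_mul, abs_of_nonneg (hw0 x), Real.abs_exp]
      linarith)
    (hh.add hh)
    (Eventually.of_forall fun x t _ => by
      have := (((hasDerivAt_id t).mul_const (l x)).exp).const_mul (w x)
      simpa using this)).2
  simpa using key

/-- The A → 0 limit of the S-divergence expression (with A + B = 1 + γ fixed):
under a domination hypothesis, the expression tends to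
∫ f^{1+γ} log(f/g) − (1/(1+γ)) ∫ (f^{1+γ} − g^{1+γ}). -/
theorem S_div_limit_A_zero {X : Type*} [MeasurableSpace X] (μ : Measure X)
    (γ : ℝ) (hγ0 : 0 ≤ γ) (hγ1 : γ < 1)
    (f g : X → ℝ) (hfm : Measurable f) (hgm : Measurable g)
    (hfpos : ∀ x, 0 < f x) (hgpos : ∀ x, 0 < g x)
    (hfint : Integrable (fun x => f x ^ (1 + γ)) μ)
    (hgint : Integrable (fun x => g x ^ (1 + γ)) μ)
    (hflog : Integrable (fun x => f x ^ (1 + γ) * |Real.log (f x / g x)|) μ)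
    (A₀ : ℝ) (hA₀ : 0 < A₀) (h : X → ℝ) (hh : Integrable h μ)
    (hdom : ∀ A : ℝ, 0 < |A| → |A| ≤ A₀ →
      (∀ᵐ x ∂μ, f x ^ (1 + γ - A) * g x ^ A ≤ h x) ∧
      (∀ᵐ x ∂μ, f x ^ (1 + γ - A) * g x ^ A * |Real.log (g x / f x)| ≤ h x)) :
    Tendsto (fun A : ℝ =>
        (1 / A) * ∫ x, f x ^ (1 + γ) ∂μ
          - ((1 + γ) / (A * (1 + γ - A))) * ∫ x, f x ^ (1 + γ - A) * g x ^ A ∂μ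
          + (1 / (1 + γ - A)) * ∫ x, g x ^ (1 + γ) ∂μ)
      (𝓝[≠] 0)
      (𝓝 ((∫ x, f x ^ (1 + γ) * Real.log (f x / g x) ∂μ)
          - (1 / (1 + γ)) * ∫ x, (f x ^ (1 + γ) - g x ^ (1 + γ)) ∂μ)) := by
  set c : ℝ := 1 + γ with hc
  have hc0 : c ≠ 0 := by positivity
  have heq : ∀ (A : ℝ) x, f x ^ (c - A) * g x ^ A
      = f x ^ c * Real.exp (A * Real.log (g x / f x)) := fun A x =>
    rpow_sub_mul_rpow_eq_mul_exp (hfpos x) (hgpos x) c A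
  simp only [heq] at hdom ⊢
  have hderiv := hasDerivAt_integral_mul_exp_mul_zero (μ := μ)
    (w := fun x => f x ^ c) (l := fun x => Real.log (g x / f x))
    (by fun_prop) (by fun_prop) (fun x => (Real.rpow_pos_of_pos (hfpos x) c).le) hfint hh hA₀
    (hdom A₀ (abs_pos.mpr hA₀.ne') (abs_of_pos hA₀).le).2
    (hdom (-A₀) (abs_pos.mpr (neg_ne_zero.mpr hA₀.ne'))
      (by rw [abs_neg, abs_of_pos hA₀])).2
  set I : ℝ → ℝ := fun A => ∫ x, f x ^ c * Real.exp (A * Real.log (g x / f x)) ∂μ with hI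
  have hI0 : I 0 = ∫ x, f x ^ c ∂μ := by simp [hI]
  have hlog : ∫ x, f x ^ c * Real.log (f x / g x) ∂μ
      = -∫ x, f x ^ c * Real.log (g x / f x) ∂μ := by
    rw [← integral_neg]
    congr 1 with x
    rw [← inv_div (g x) (f x), Real.log_inv, mul_neg]
  have hslope := hasDerivAt_iff_tendsto_slope.mp hderiv
  have hcont : Tendsto I (𝓝[≠] 0) (𝓝 (I 0)) :=
    hderiv.continuousAt.tendsto.mono_left nhdsWithin_le_nhds
  have hinv : Tendsto (fun A : ℝ => 1 / (c - A)) (𝓝[≠] 0) (𝓝 (1 / c)) := by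
    have : ContinuousAt (fun A : ℝ => 1 / (c - A)) 0 :=
      continuousAt_const.div (by fun_prop) (by simpa using hc0)
    simpa using this.tendsto.mono_left nhdsWithin_le_nhds
  have hlim := hslope.neg.sub
    (hinv.mul (hcont.sub (tendsto_const_nhds (x := ∫ x, g x ^ c ∂μ))))
  rw [hlog, integral_sub hfint hgint, ← hI0]
  refine hlim.congr' ?_
  have hne : ∀ᶠ A : ℝ in 𝓝[≠] 0, c - A ≠ 0 := by
    have : ContinuousAt (fun A : ℝ => c - A) 0 := by fun_prop
    exact (this.eventually_ne (by simpa using hc0)).filter_mono nhdsWithin_le_nhds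
  filter_upwards [hne, self_mem_nhdsWithin] with A hA hA0
  have hA0' : A ≠ 0 := hA0
  change -slope I 0 A - 1 / (c - A) * (I A - _)
    = 1 / A * I 0 - c / (A * (c - A)) * I A + 1 / (c - A) * _
  rw [slope_def_field, sub_zero]
  field_simp
  ring
end

section
/- Fix γ ∈ [0,1) and strictly positive measurable densities f, g on a measure space (X, μ) with f^{1+γ} and g^{1+γ} integrable and with g^{1+γ}·|log(g/f)| integrable. Suppose there exist B₀ > 0 and an integrable function h such that for all B with 0 < |B| ≤ B₀, both f^B g^{1+γ−B} ≤ h and f^B g^{1+γ−B} |log(f/g)| ≤ h pointwise μ-a.e. Then, writing A = 1 + γ − B, the function B ↦ (1/A)∫f^{1+γ} dμ − ((1+γ)/(AB))∫ f^B g^A dμ + (1/B)∫ g^{1+γ} dμ tends, as B → 0 with B ≠ 0, to the limit ∫ g^{1+γ} log(g/f) dμ − (1/(1+γ))∫ (g^{1+γ} − f^{1+γ}) dμ. -/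
open MeasureTheory Filter Topology

/-- Tilting a density along the exponential path `B ↦ u ^ B * v ^ (c - B)`. -/
lemma rpow_mul_rpow_sub_eq_mul_exp {u v : ℝ} (hu : 0 < u) (hv : 0 < v) (c B : ℝ) :
    u ^ B * v ^ (c - B) = v ^ c * Real.exp (B * Real.log (u / v)) := by
  rw [Real.rpow_def_of_pos hu, Real.rpow_def_of_pos hv, Real.rpow_def_of_pos hv,
    Real.log_div hu.ne' hv.ne', ← Real.exp_add, ← Real.exp_add]
  congr 1
  ring

/-- A bound on `w * exp (t * l) * |l|` at `t = r` and `t = -r` holds on all of `[-r, r]`. -/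
lemma mul_exp_mul_abs_le_of_endpoints {w l r b t : ℝ} (hw : 0 ≤ w) (ht : |t| ≤ r)
    (hpos : w * Real.exp (r * l) * |l| ≤ b) (hneg : w * Real.exp (-r * l) * |l| ≤ b) :
    w * Real.exp (t * l) * |l| ≤ b := by
  obtain ⟨h₁, h₂⟩ := abs_le.mp ht
  rcases le_total 0 l with hl | hl
  · refine le_trans ?_ hpos
    gcongr
  · refine le_trans ?_ hneg
    have : t * l ≤ -r * l := mul_le_mul_of_nonpos_right h₁ hl
    gcongr

/-- If `w * exp (t * l) * |l|` is dominated by an integrable function at `t = r` and `t = -r`,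
then `t ↦ ∫ w * exp (t * l)` is differentiable at `0`. -/
lemma hasDerivAt_integral_mul_exp {X : Type*} [MeasurableSpace X] {μ : Measure X}
    {w l b : X → ℝ} {r : ℝ} (hr : 0 < r) (hw : Measurable w) (hl : Measurable l)
    (hw0 : ∀ x, 0 ≤ w x) (hwint : Integrable w μ) (hb : Integrable b μ)
    (hpos : ∀ᵐ x ∂μ, w x * Real.exp (r * l x) * |l x| ≤ b x)
    (hneg : ∀ᵐ x ∂μ, w x * Real.exp (-r * l x) * |l x| ≤ b x) :
    HasDerivAt (fun t : ℝ => ∫ x, w x * Real.exp (t * l x) ∂μ) (∫ x, w x * l x ∂μ) 0 := by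
  have key := (hasDerivAt_integral_of_dominated_loc_of_deriv_le (μ := μ) (𝕜 := ℝ) (x₀ := 0)
    (F := fun t x => w x * Real.exp (t * l x))
    (F' := fun t x => w x * Real.exp (t * l x) * l x) (bound := b)
    (Metric.ball_mem_nhds (0 : ℝ) hr) ?_ ?_ ?_ ?_ hb ?_).2
  · simpa using key
  · exact Eventually.of_forall fun t => (by fun_prop : Measurable _).aestronglyMeasurable
  · simpa using hwint
  · exact (by fun_prop : Measurable _).aestronglyMeasurable
  · filter_upwards [hpos, hneg] with x hx₁ hx₂ t ht
    rw [Real.norm_eq_abs, abs_mul, abs_of_nonneg (mul_nonneg (hw0 x) (Real.exp_pos _).le)]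
    refine mul_exp_mul_abs_le_of_endpoints (hw0 x) ?_ hx₁ hx₂
    simpa using (mem_ball_zero_iff.mp ht).le
  · refine Eventually.of_forall fun x t _ => ?_
    simpa [mul_assoc] using (((hasDerivAt_id t).mul_const (l x)).exp).const_mul (w x)

/-- The B → 0 limit of the S-divergence expression (with A + B = 1 + γ fixed):
under a domination hypothesis, the expression tends to
∫ g^{1+γ} log(g/f) − (1/(1+γ)) ∫ (g^{1+γ} − f^{1+γ}). -/
theorem S_div_limit_B_zero {X : Type*} [MeasurableSpace X] (μ : Measure X)
    (γ : ℝ) (hγ0 : 0 ≤ γ) (hγ1 : γ < 1)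
    (f g : X → ℝ) (hfm : Measurable f) (hgm : Measurable g)
    (hfpos : ∀ x, 0 < f x) (hgpos : ∀ x, 0 < g x)
    (hfint : Integrable (fun x => f x ^ (1 + γ)) μ)
    (hgint : Integrable (fun x => g x ^ (1 + γ)) μ)
    (hglog : Integrable (fun x => g x ^ (1 + γ) * |Real.log (g x / f x)|) μ)
    (B₀ : ℝ) (hB₀ : 0 < B₀) (h : X → ℝ) (hh : Integrable h μ)
    (hdom : ∀ B : ℝ, 0 < |B| → |B| ≤ B₀ →
      (∀ᵐ x ∂μ, f x ^ B * g x ^ (1 + γ - B) ≤ h x) ∧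
      (∀ᵐ x ∂μ, f x ^ B * g x ^ (1 + γ - B) * |Real.log (f x / g x)| ≤ h x)) :
    Tendsto (fun B : ℝ =>
        (1 / (1 + γ - B)) * ∫ x, f x ^ (1 + γ) ∂μ
          - ((1 + γ) / ((1 + γ - B) * B)) * ∫ x, f x ^ B * g x ^ (1 + γ - B) ∂μ
          + (1 / B) * ∫ x, g x ^ (1 + γ) ∂μ)
      (𝓝[≠] 0)
      (𝓝 ((∫ x, g x ^ (1 + γ) * Real.log (g x / f x) ∂μ)
          - (1 / (1 + γ)) * ∫ x, (g x ^ (1 + γ) - f x ^ (1 + γ)) ∂μ)) := by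
  have hderiv : HasDerivAt (fun B : ℝ => ∫ x, f x ^ B * g x ^ (1 + γ - B) ∂μ)
      (∫ x, g x ^ (1 + γ) * Real.log (f x / g x) ∂μ) 0 := by
    simp_rw [fun B x => rpow_mul_rpow_sub_eq_mul_exp (hfpos x) (hgpos x) (1 + γ) B] at hdom ⊢
    have hB₀abs : |B₀| = B₀ := abs_of_pos hB₀
    exact hasDerivAt_integral_mul_exp hB₀ (by fun_prop) (by fun_prop)
      (fun x => Real.rpow_nonneg (hgpos x).le _) hgint hh
      (hdom B₀ (by rwa [hB₀abs]) hB₀abs.le).2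
      (hdom (-B₀) (by rwa [abs_neg, hB₀abs]) (by rw [abs_neg, hB₀abs])).2
  have hγ : 1 + γ ≠ 0 := by positivity
  have hA : Tendsto (fun B : ℝ => 1 + γ - B) (𝓝[≠] 0) (𝓝 (1 + γ)) := by
    have : Continuous fun B : ℝ => 1 + γ - B := by fun_prop
    simpa using (this.tendsto 0).mono_left nhdsWithin_le_nhds
  have hlim := ((hA.inv₀ hγ).mul_const
    ((∫ x, f x ^ (1 + γ) ∂μ) - ∫ x, g x ^ (1 + γ) ∂μ)).sub
    (((hA.inv₀ hγ).const_mul (1 + γ)).mul hderiv.tendsto_slope_zero)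
  have hlog : ∫ x, g x ^ (1 + γ) * Real.log (g x / f x) ∂μ
      = -∫ x, g x ^ (1 + γ) * Real.log (f x / g x) ∂μ := by
    rw [← integral_neg]
    refine integral_congr_ae (Eventually.of_forall fun x => ?_)
    simp only
    rw [← inv_div (f x) (g x), Real.log_inv, mul_neg]
  rw [hlog, integral_sub hgint hfint]
  convert hlim.congr' ?_ using 2
  · field_simp
    ring
  · filter_upwards [self_mem_nhdsWithin, hA.eventually_ne hγ] with B hB hAB
    have hB : B ≠ 0 := hB
    simp only [zero_add, Real.rpow_zero, one_mul, sub_zero, smul_eq_mul]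
    field_simp
    ring
end

section
/- Let σ > 0, θ₀, θ₁ ∈ ℝ, γ ∈ [0,1], λ ∈ ℝ, and set A = 1 + λ(1−γ), B = γ − λ(1−γ); assume A ≠ 0 and B ≠ 0. Then the S-divergence between the normal densities with common variance satisfies S₍γ,λ₎(φ_{θ₁,σ}, φ_{θ₀,σ}) = κ_γ · ((1+γ)/(A·B)) · [1 − exp(−A·B·(θ₁−θ₀)² / (2·(1+γ)·σ²))], where κ_γ = (2π)^{−γ/2}·σ^{−γ}·(1+γ)^{−1/2}. -/
open MeasureTheory Real

/-- The density of N(θ, σ²) on ℝ. -/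
noncomputable def normalPDF (θ σ : ℝ) (x : ℝ) : ℝ :=
  (Real.sqrt (2 * Real.pi) * σ)⁻¹ * Real.exp (-(x - θ) ^ 2 / (2 * σ ^ 2))

theorem normalPDF_rpow {σ : ℝ} (hσ : 0 < σ) (θ p x : ℝ) :
    normalPDF θ σ x ^ p
      = ((2 * π) ^ (-p / 2) * σ ^ (-p)) * exp (-(x - θ) ^ 2 / (2 * σ ^ 2) * p) := by
  have h2π : (0 : ℝ) < 2 * π := by positivity
  rw [normalPDF, mul_rpow (by positivity) (exp_pos _).le, ← exp_mul,
    inv_rpow (by positivity), ← rpow_neg (by positivity), mul_rpow (by positivity) hσ.le,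
    sqrt_eq_rpow, ← rpow_mul h2π.le]
  ring_nf

/-- Mass of a Gaussian kernel, with the normalisation of a power `s` of a normal density. -/
theorem rpow_mul_integral_gaussian {σ s : ℝ} (hσ : 0 < σ) (hs : 0 < s) (m : ℝ) :
    ((2 * π) ^ (-s / 2) * σ ^ (-s)) * ∫ x : ℝ, exp (-(s / (2 * σ ^ 2)) * (x - m) ^ 2)
      = (2 * π) ^ ((1 - s) / 2) * σ ^ (1 - s) * s ^ (-(1 : ℝ) / 2) := by
  have h2π : (0 : ℝ) < 2 * π := by positivity
  have hsqrt : √(π / (s / (2 * σ ^ 2))) = (2 * π) ^ ((1 : ℝ) / 2) * σ * s ^ (-(1 : ℝ) / 2) := by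
    have : π / (s / (2 * σ ^ 2)) = 2 * π * σ ^ 2 / s := by field_simp
    rw [this, sqrt_div (by positivity), sqrt_mul h2π.le, sqrt_sq hσ.le, sqrt_eq_rpow,
      sqrt_eq_rpow, neg_div, rpow_neg hs.le, div_eq_mul_inv]
  rw [integral_sub_right_eq_self (fun x : ℝ => exp (-(s / (2 * σ ^ 2)) * x ^ 2)) m,
    integral_gaussian, hsqrt, show (1 - s) / 2 = -s / 2 + 1 / 2 by ring,
    show 1 - s = -s + 1 by ring, rpow_add h2π, rpow_add hσ, rpow_one]
  ring

theorem integral_normalPDF_rpow_mul_rpow {σ a b : ℝ} (hσ : 0 < σ) (hab : 0 < a + b)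
    (θ₀ θ₁ : ℝ) :
    ∫ x : ℝ, normalPDF θ₀ σ x ^ b * normalPDF θ₁ σ x ^ a
      = (2 * π) ^ ((1 - (a + b)) / 2) * σ ^ (1 - (a + b)) * (a + b) ^ (-(1 : ℝ) / 2)
        * exp (-(a * b * (θ₁ - θ₀) ^ 2) / (2 * (a + b) * σ ^ 2)) := by
  have h2π : (0 : ℝ) < 2 * π := by positivity
  rw [← rpow_mul_integral_gaussian hσ hab ((b * θ₀ + a * θ₁) / (a + b)),
    ← integral_const_mul, ← integral_mul_const]
  congr 1 with x
  have hexp : exp (-(x - θ₀) ^ 2 / (2 * σ ^ 2) * b) * exp (-(x - θ₁) ^ 2 / (2 * σ ^ 2) * a)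
      = exp (-((a + b) / (2 * σ ^ 2)) * (x - (b * θ₀ + a * θ₁) / (a + b)) ^ 2)
        * exp (-(a * b * (θ₁ - θ₀) ^ 2) / (2 * (a + b) * σ ^ 2)) := by
    rw [← exp_add, ← exp_add]
    congr 1
    field_simp
    ring
  rw [normalPDF_rpow hσ, normalPDF_rpow hσ, mul_assoc (_ * _) (exp _) (exp _), ← hexp,
    show -(a + b) / 2 = -b / 2 + -a / 2 by ring, show -(a + b) = -b + -a by ring,
    rpow_add h2π, rpow_add hσ]
  ring

theorem integral_normalPDF_rpow {σ p : ℝ} (hσ : 0 < σ) (hp : 0 < p) (θ : ℝ) :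
    ∫ x : ℝ, normalPDF θ σ x ^ p
      = (2 * π) ^ ((1 - p) / 2) * σ ^ (1 - p) * p ^ (-(1 : ℝ) / 2) := by
  simpa using integral_normalPDF_rpow_mul_rpow (a := 0) (b := p) hσ (by simpa using hp) θ θ

/-- Closed form of the S-divergence between two equal-variance normal densities:
S₍γ,λ₎(φ_{θ₁,σ}, φ_{θ₀,σ}) = κ_γ ((1+γ)/(AB)) (1 − exp(−AB(θ₁−θ₀)²/(2(1+γ)σ²))). -/
theorem S_div_normal (σ θ₀ θ₁ γ lam : ℝ) (hσ : 0 < σ)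
    (hγ0 : 0 ≤ γ) (hγ1 : γ ≤ 1) (A B : ℝ)
    (hA : A = 1 + lam * (1 - γ)) (hB : B = γ - lam * (1 - γ))
    (hA0 : A ≠ 0) (hB0 : B ≠ 0) :
    (1 / A) * (∫ x : ℝ, (normalPDF θ₀ σ x) ^ (1 + γ))
      - ((1 + γ) / (A * B)) * (∫ x : ℝ, (normalPDF θ₀ σ x) ^ B * (normalPDF θ₁ σ x) ^ A)
      + (1 / B) * (∫ x : ℝ, (normalPDF θ₁ σ x) ^ (1 + γ))
    = ((2 * Real.pi) ^ (-γ / 2) * σ ^ (-γ) * (1 + γ) ^ (-(1 : ℝ) / 2))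
        * ((1 + γ) / (A * B))
        * (1 - Real.exp (-(A * B * (θ₁ - θ₀) ^ 2) / (2 * (1 + γ) * σ ^ 2))) := by
  have hAB : A + B = 1 + γ := by rw [hA, hB]; ring
  have hpos : 0 < 1 + γ := by linarith
  rw [integral_normalPDF_rpow hσ hpos, integral_normalPDF_rpow hσ hpos,
    integral_normalPDF_rpow_mul_rpow hσ (hAB ▸ hpos), hAB, show 1 - (1 + γ) = -γ by ring]
  have hinv : 1 / A + 1 / B = (1 + γ) / (A * B) := by
    rw [← hAB]
    field_simp
    ring
  rw [← hinv]
  ring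
end

section
/- Let σ > 0, θ₀ ∈ ℝ, γ ≥ 0, β ≥ 0, and consider the second-order influence function of the S-divergence test in the normal model, IF₂(y) = ((1+β)^{3/2} / ((√(2π)·σ)^{β+γ} · σ⁴ · √(1+γ))) · (y − θ₀)² · exp(−β·(y − θ₀)²/σ²) for y ∈ ℝ. If β > 0, then IF₂ is bounded on ℝ with supremum (over y ∈ ℝ) equal to ((1+β)^{3/2} / ((√(2π)·σ)^{β+γ} · σ⁴ · √(1+γ))) · σ²/(β·e), attained exactly at y = θ₀ ± σ/√β. If β = 0, then IF₂ is unbounded on ℝ. -/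
open Real

theorem Real.mul_exp_neg_eq_exp_neg_one_iff (u : ℝ) :
    u * Real.exp (-u) = Real.exp (-1) ↔ u = 1 := by
  refine ⟨fun h => ?_, fun h => by simp [h]⟩
  by_contra hu
  have hlt : u < Real.exp (u - 1) := by
    linarith [Real.add_one_lt_exp (sub_ne_zero.mpr hu)]
  have : u * Real.exp (-u) < Real.exp (u - 1) * Real.exp (-u) := by gcongr
  rw [← Real.exp_add, h] at this
  ring_nf at this
  exact lt_irrefl _ this

/-- Boundedness of the second-order influence function of the S-divergence test
in the normal model: for β > 0 its supremum is C σ²/(β e), attained exactly at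
y = θ₀ ± σ/√β; for β = 0 it is unbounded. -/
theorem IF2_boundedness_normal (σ θ₀ γ β : ℝ) (hσ : 0 < σ) (hγ : 0 ≤ γ) (hβ : 0 ≤ β)
    (C : ℝ)
    (hC : C = (1 + β) ^ ((3 : ℝ) / 2)
      / ((Real.sqrt (2 * Real.pi) * σ) ^ (β + γ) * σ ^ 4 * Real.sqrt (1 + γ)))
    (IF₂ : ℝ → ℝ)
    (hIF : ∀ y, IF₂ y = C * (y - θ₀) ^ 2 * Real.exp (-β * (y - θ₀) ^ 2 / σ ^ 2)) :
    (0 < β →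
      IsGreatest (Set.range IF₂) (C * σ ^ 2 / (β * Real.exp 1)) ∧
      (∀ y, IF₂ y = C * σ ^ 2 / (β * Real.exp 1) ↔
        (y = θ₀ + σ / Real.sqrt β ∨ y = θ₀ - σ / Real.sqrt β))) ∧
    (β = 0 → ¬ BddAbove (Set.range IF₂)) := by
  have hCpos : 0 < C := by
    have : 0 < 2 * Real.pi := by positivity
    rw [hC]
    positivity
  refine ⟨fun hβ' => ?_, ?_⟩
  · have hK : 0 < C * σ ^ 2 / β := by positivity
    have hmax : C * σ ^ 2 / (β * Real.exp 1) = C * σ ^ 2 / β * Real.exp (-1) := by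
      rw [Real.exp_neg]
      field_simp
    have hform (y : ℝ) : IF₂ y = C * σ ^ 2 / β *
        (β * (y - θ₀) ^ 2 / σ ^ 2 * Real.exp (-(β * (y - θ₀) ^ 2 / σ ^ 2))) := by
      rw [hIF, neg_mul, neg_div]
      field_simp
    have hiff (y : ℝ) : IF₂ y = C * σ ^ 2 / (β * Real.exp 1) ↔
        (y = θ₀ + σ / Real.sqrt β ∨ y = θ₀ - σ / Real.sqrt β) := by
      have hsq : β * (y - θ₀) ^ 2 / σ ^ 2 = 1 ↔ (y - θ₀) ^ 2 = (σ / Real.sqrt β) ^ 2 := by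
        rw [div_pow, Real.sq_sqrt hβ, div_eq_one_iff_eq (by positivity),
          eq_div_iff hβ'.ne', mul_comm]
      rw [hform, hmax, mul_right_inj' hK.ne', Real.mul_exp_neg_eq_exp_neg_one_iff, hsq,
        sq_eq_sq_iff_eq_or_eq_neg]
      refine or_congr ?_ ?_ <;> constructor <;> intro h <;> linarith
    refine ⟨⟨⟨_, (hiff _).mpr (Or.inl rfl)⟩, ?_⟩, hiff⟩
    rintro _ ⟨y, rfl⟩
    rw [hform, hmax]
    exact mul_le_mul_of_nonneg_left (Real.mul_exp_neg_le_exp_neg_one _) hK.le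
  · rintro rfl ⟨M, hM⟩
    have h := hM ⟨θ₀ + (|M| / C + 1), rfl⟩
    have hbase : 0 ≤ |M| / C := by positivity
    have hval : IF₂ (θ₀ + (|M| / C + 1)) = C * (|M| / C + 1) ^ 2 := by
      rw [hIF]
      simp
    have hlt : M < C * (|M| / C + 1) ^ 2 := by
      calc M ≤ C * (|M| / C) := by rw [mul_div_cancel₀ _ hCpos.ne']; exact le_abs_self M
        _ < C * (|M| / C + 1) ^ 2 := by
          gcongr
          nlinarith
    linarith
end
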